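/- arXiv:1808.05389 — 2 statements merged into one kernel-verified Lean document; each statement's English description precedes it below -/
import Mathlib

section
/- There exists a constant C > 0 such that for every n ≥ 2 and every initial load vector ℓ⁰ ∈ ℕⁿ with initial discrepancy Δ = maxᵢ ℓ⁰ᵢ − minᵢ ℓ⁰ᵢ ≥ 1: letting t = ⌈C·n·(log n + log Δ)⌉, the probability under the t-fold iterate of the one-step balancing kernel started from ℓ⁰ that every node's load lies in the interval [ā − 20, ā + 20] is at least 1 − C/n. -/
open scoped BigOperators

/-- `balance ℓ u v` replaces `ℓ u` by `⌈(ℓ u + ℓ v)/2⌉` and `ℓ v` by `⌊(ℓ u + ℓ v)/2⌋`. -/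
noncomputable def balance {n : ℕ} (ℓ : Fin n → ℤ) (u v : Fin n) : Fin n → ℤ :=
  fun i =>
    if i = u then ⌈(((ℓ u + ℓ v : ℤ) : ℚ)) / 2⌉
    else if i = v then ⌊(((ℓ u + ℓ v : ℤ) : ℚ)) / 2⌋
    else ℓ i

/-- The one-step balancing kernel: from state `ℓ`, pick an ordered pair `(u, v)` of distinct
nodes uniformly at random (each with probability `1/(n(n−1))`) and move to `balance ℓ u v`. -/
noncomputable def stepPMF {n : ℕ} (hn : 2 ≤ n) (ℓ : Fin n → ℤ) : PMF (Fin n → ℤ) :=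
  (PMF.uniformOfFinset
      (Finset.univ.filter (fun p : Fin n × Fin n => p.1 ≠ p.2))
      ⟨(⟨0, by omega⟩, ⟨1, by omega⟩), by
        simp [Finset.mem_filter, Fin.ext_iff]⟩).map
    (fun p => balance ℓ p.1 p.2)

/-- The distribution of the load vector after `t` steps of the balancing process
started from `ℓ0`. -/
noncomputable def iterPMF {n : ℕ} (hn : 2 ≤ n) (ℓ0 : Fin n → ℤ) : ℕ → PMF (Fin n → ℤ)
  | 0 => PMF.pure ℓ0
  | (t + 1) => (iterPMF hn ℓ0 t).bind (stepPMF hn)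

section Helpers

variable {n : ℕ}

theorem balance_spec (ℓ : Fin n → ℤ) {u v : Fin n} (huv : u ≠ v) :
    balance ℓ u v u + balance ℓ u v v = ℓ u + ℓ v ∧
      balance ℓ u v v ≤ balance ℓ u v u ∧ balance ℓ u v u ≤ balance ℓ u v v + 1 := by
  have h1 : balance ℓ u v u = ⌈(((ℓ u + ℓ v : ℤ) : ℚ)) / 2⌉ := by simp [balance]
  have h2 : balance ℓ u v v = ⌊(((ℓ u + ℓ v : ℤ) : ℚ)) / 2⌋ := by simp [balance, huv.symm]
  have h3 : ⌊(((ℓ u + ℓ v : ℤ) : ℚ)) / 2⌋ = (ℓ u + ℓ v) / 2 := by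
    have := Rat.floor_intCast_div_natCast (ℓ u + ℓ v) 2
    simpa using this
  have h4 : ⌈(((ℓ u + ℓ v : ℤ) : ℚ)) / 2⌉ = -((-(ℓ u + ℓ v)) / 2) := by
    have := Rat.floor_intCast_div_natCast (-(ℓ u + ℓ v)) 2
    have h5 : (((-(ℓ u + ℓ v) : ℤ) : ℚ) / ((2 : ℕ) : ℚ)) = -((((ℓ u + ℓ v : ℤ) : ℚ)) / 2) := by
      push_cast; ring
    rw [h5, Int.floor_neg] at this
    have h6 : ((2 : ℕ) : ℤ) = 2 := rfl
    rw [h6] at this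
    omega
  rw [h1, h2, h3, h4]
  omega

theorem balance_of_ne (ℓ : Fin n → ℤ) {u v i : Fin n} (hu : i ≠ u) (hv : i ≠ v) :
    balance ℓ u v i = ℓ i := by
  simp [balance, hu, hv]

theorem sum_balance {M : Type*} [AddCommGroup M] (F : ℤ → M) (ℓ : Fin n → ℤ) {u v : Fin n}
    (huv : u ≠ v) :
    ∑ i, F (balance ℓ u v i) = ∑ i, F (ℓ i) +
      (F (balance ℓ u v u) + F (balance ℓ u v v) - (F (ℓ u) + F (ℓ v))) := by
  have h : ∑ i, (F (balance ℓ u v i) - F (ℓ i)) =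
      (F (balance ℓ u v u) - F (ℓ u)) + (F (balance ℓ u v v) - F (ℓ v)) := by
    refine Finset.sum_eq_add u v huv ?_ (by simp) (by simp)
    rintro i - ⟨hu, hv⟩
    rw [balance_of_ne ℓ hu hv, sub_self]
  rw [Finset.sum_sub_distrib] at h
  rw [sub_eq_iff_eq_add.mp h]
  abel

theorem sum_balance_id (ℓ : Fin n → ℤ) {u v : Fin n} (huv : u ≠ v) :
    ∑ i, balance ℓ u v i = ∑ i, ℓ i := by
  have h := sum_balance (fun z => z) ℓ huv
  have h' := (balance_spec ℓ huv).1
  simp only [h', sub_self, add_zero] at h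
  exact h

/-- Balancing two integers does not increase the sum of a convex function of them. -/
theorem ConvexOn.balance_le {f : ℝ → ℝ} (hf : ConvexOn ℝ Set.univ f) {x y c d : ℤ}
    (hs : c + d = x + y) (hdc : d ≤ c) (hcd : c ≤ d + 1) (a : ℝ) :
    f (c - a) + f (d - a) ≤ f (x - a) + f (y - a) := by
  have key : ∀ {x y : ℤ}, c + d = x + y → y ≤ x →
      f (c - a) + f (d - a) ≤ f (x - a) + f (y - a) := by
    intro x y hs hyx
    rcases hyx.eq_or_lt with rfl | hlt
    · have h1 : c = y := by omega
      have h2 : d = y := by omega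
      rw [h1, h2]
    have hpos : (0 : ℝ) < x - y := by
      have : (y : ℝ) < x := by exact_mod_cast hlt
      linarith
    have hsum : (c : ℝ) + d = x + y := by exact_mod_cast hs
    have hcy : (y : ℝ) ≤ c := by exact_mod_cast (by omega : y ≤ c)
    have hcx : (c : ℝ) ≤ x := by exact_mod_cast (by omega : c ≤ x)
    set p : ℝ := (c - y) / (x - y) with hp
    set q : ℝ := (x - c) / (x - y) with hq
    have hp0 : 0 ≤ p := div_nonneg (by linarith) hpos.le
    have hq0 : 0 ≤ q := div_nonneg (by linarith) hpos.le
    have hpq : p + q = 1 := by rw [hp, hq]; field_simp; ring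
    have e1 : p * (x - a) + q * (y - a) = c - a := by rw [hp, hq]; field_simp; ring
    have e2 : q * (x - a) + p * (y - a) = d - a := by
      have hd : (d : ℝ) = x + y - c := by linarith
      rw [hp, hq, hd]; field_simp; ring
    have i1 := hf.2 (Set.mem_univ (x - a : ℝ)) (Set.mem_univ (y - a : ℝ)) hp0 hq0 hpq
    have i2 := hf.2 (Set.mem_univ (x - a : ℝ)) (Set.mem_univ (y - a : ℝ)) hq0 hp0
      (by linarith)
    simp only [smul_eq_mul, e1, e2] at i1 i2
    have hq' : q = 1 - p := by linarith
    rw [hq'] at i1 i2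
    linarith
  rcases le_total y x with h | h
  · exact key hs h
  · rw [add_comm (f (x - a))]
    exact key (by omega) h

/-- The squared excess of `|x|` over `3`. -/
noncomputable def excessSq (x : ℝ) : ℝ := (max (|x| - 3) 0) ^ 2

theorem excessSq_nonneg (x : ℝ) : 0 ≤ excessSq x := sq_nonneg _

theorem excessSq_le_sq (x : ℝ) : excessSq x ≤ x ^ 2 := by
  rw [excessSq, ← sq_abs x]
  exact pow_le_pow_left₀ (le_max_right _ _)
    (max_le (by linarith [abs_nonneg x]) (abs_nonneg x)) 2

theorem convexOn_excessSq : ConvexOn ℝ Set.univ excessSq := by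
  have h1 : ConvexOn ℝ Set.univ (fun x : ℝ => |x| - 3) := by
    have h : ConvexOn ℝ Set.univ (fun x : ℝ => |x| + -3) :=
      (convexOn_norm (E := ℝ) convex_univ).add_const (-3)
    simpa only [sub_eq_add_neg] using h
  have h2 := (h1.sup (convexOn_const (0 : ℝ) convex_univ)).pow
    (fun x _ => le_max_right _ _) 2
  exact h2

theorem excessSq_eq_zero {x : ℝ} (h : |x| ≤ 3) : excessSq x = 0 := by
  rw [excessSq, max_eq_right (by linarith)]; norm_num

theorem excessSq_half {x z : ℝ} (h : |z| ≤ (|x| + 3) / 2) : excessSq z ≤ excessSq x / 4 := by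
  have h1 : max (|z| - 3) 0 ≤ max (|x| - 3) 0 / 2 :=
    max_le (by linarith [le_max_left (|x| - 3) 0]) (by linarith [le_max_right (|x| - 3) 0])
  have h2 := pow_le_pow_left₀ (le_max_right _ _) h1 2
  simp only [excessSq]
  linarith [h2, div_pow (max (|x| - 3) 0) 2 2]

/-- Balancing with a node whose deviation is at most `2` halves the excess. -/
theorem excessSq_balance_le {x y c d : ℤ} {a : ℝ}
    (hs : c + d = x + y) (hdc : d ≤ c) (hcd : c ≤ d + 1) (hy : |(y : ℝ) - a| ≤ 2) :
    excessSq (c - a) + excessSq (d - a) ≤ excessSq (x - a) / 2 := by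
  have hsum : (c : ℝ) + d = x + y := by exact_mod_cast hs
  have h1 : (d : ℝ) ≤ c := by exact_mod_cast hdc
  have h2 : (c : ℝ) ≤ d + 1 := by exact_mod_cast hcd
  obtain ⟨y1, y2⟩ := abs_le.mp hy
  have x1 := le_abs_self ((x : ℝ) - a)
  have x2 := neg_abs_le ((x : ℝ) - a)
  have hc : excessSq (c - a) ≤ excessSq (x - a) / 4 :=
    excessSq_half (abs_le.mpr ⟨by linarith, by linarith⟩)
  have hd : excessSq (d - a) ≤ excessSq (x - a) / 4 :=
    excessSq_half (abs_le.mpr ⟨by linarith, by linarith⟩)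
  linarith

/-- The sum of the squared deviations of the loads from `a`. -/
noncomputable def quadPot (a : ℝ) (ℓ : Fin n → ℤ) : ℝ := ∑ i, ((ℓ i : ℝ) - a) ^ 2

/-- The sum of the squared excess deviations of the loads from `a`. -/
noncomputable def excessPot (a : ℝ) (ℓ : Fin n → ℤ) : ℝ := ∑ i, excessSq ((ℓ i : ℝ) - a)

theorem excessPot_nonneg (a : ℝ) (ℓ : Fin n → ℤ) : 0 ≤ excessPot a ℓ :=
  Finset.sum_nonneg fun _ _ => excessSq_nonneg _

theorem excessPot_le_quadPot (a : ℝ) (ℓ : Fin n → ℤ) : excessPot a ℓ ≤ quadPot a ℓ :=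
  Finset.sum_le_sum fun _ _ => excessSq_le_sq _

theorem quadPot_balance_le (a : ℝ) (ℓ : Fin n → ℤ) {u v : Fin n} (huv : u ≠ v) :
    quadPot a (balance ℓ u v) ≤ quadPot a ℓ := by
  obtain ⟨h1, h2, h3⟩ := balance_spec ℓ huv
  have hf : ConvexOn ℝ Set.univ (fun x : ℝ => x ^ 2) := Even.convexOn_pow even_two
  have h := hf.balance_le h1 h2 h3 a
  have e := sum_balance (fun z : ℤ => ((z : ℝ) - a) ^ 2) ℓ huv
  simp only [quadPot]
  linarith

theorem quadPot_balance_le_sub (a : ℝ) (ℓ : Fin n → ℤ) {u v : Fin n} (huv : u ≠ v) :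
    quadPot a (balance ℓ u v) ≤ quadPot a ℓ + 1 / 2 - ((ℓ u : ℝ) - ℓ v) ^ 2 / 2 := by
  obtain ⟨h1, h2, h3⟩ := balance_spec ℓ huv
  have e := sum_balance (fun z : ℤ => ((z : ℝ) - a) ^ 2) ℓ huv
  simp only [quadPot]
  rw [e]
  generalize balance ℓ u v u = c at *
  generalize balance ℓ u v v = d at *
  have hsum : (c : ℝ) = ℓ u + ℓ v - d := by
    have : (c : ℝ) + d = ℓ u + ℓ v := by exact_mod_cast h1
    linarith
  have hdc : (d : ℝ) ≤ c := by exact_mod_cast h2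
  have hcd : (c : ℝ) ≤ d + 1 := by exact_mod_cast h3
  rw [hsum] at hdc hcd ⊢
  nlinarith [mul_nonneg (sub_nonneg.mpr hdc) (sub_nonneg.mpr hcd)]

/-- The ordered pairs of distinct nodes. -/
def pairs (n : ℕ) : Finset (Fin n × Fin n) :=
  Finset.univ.filter (fun p : Fin n × Fin n => p.1 ≠ p.2)

theorem mem_pairs {p : Fin n × Fin n} : p ∈ pairs n ↔ p.1 ≠ p.2 := by simp [pairs]

theorem card_pairs : ((pairs n).card : ℝ) = n * (n - 1) := by
  have h : pairs n = (Finset.univ : Finset (Fin n)).offDiag := by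
    ext p; simp [pairs, Finset.mem_offDiag]
  rw [h, Finset.offDiag_card, Nat.cast_sub (Nat.le_mul_self _)]
  simp; ring

theorem sum_sq_sub {a : ℝ} {ℓ : Fin n → ℤ} (ha : ∑ i, (ℓ i : ℝ) = n * a) :
    ∑ p ∈ pairs n, ((ℓ p.1 : ℝ) - ℓ p.2) ^ 2 = 2 * n * quadPot a ℓ := by
  have h : ∑ p ∈ pairs n, ((ℓ p.1 : ℝ) - ℓ p.2) ^ 2 =
      ∑ p : Fin n × Fin n, ((ℓ p.1 : ℝ) - ℓ p.2) ^ 2 := by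
    refine Finset.sum_subset (Finset.subset_univ _) ?_
    intro p _ hp
    have : p.1 = p.2 := by simpa [pairs] using hp
    simp [this]
  have h0 : ∑ i, ((ℓ i : ℝ) - a) = 0 := by simp [Finset.sum_sub_distrib, ha]
  have h1 : ∀ u v : Fin n, ((ℓ u : ℝ) - ℓ v) ^ 2 =
      ((ℓ u : ℝ) - a) ^ 2 + ((ℓ v : ℝ) - a) ^ 2 - 2 * ((ℓ u : ℝ) - a) * ((ℓ v : ℝ) - a) := by
    intro u v; ring
  rw [h, Fintype.sum_prod_type]
  simp only [h1, Finset.sum_sub_distrib, Finset.sum_add_distrib, ← Finset.mul_sum, h0, mul_zero,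
    Finset.sum_const_zero, Finset.sum_const, Finset.card_univ, Fintype.card_fin, nsmul_eq_mul,
    quadPot]
  ring

theorem sum_quadPot_balance_le (hn : 2 ≤ n) {a : ℝ} {ℓ : Fin n → ℤ}
    (ha : ∑ i, (ℓ i : ℝ) = n * a) (hΦ : n < quadPot a ℓ) :
    ∑ p ∈ pairs n, quadPot a (balance ℓ p.1 p.2) ≤
      (pairs n).card * ((1 - 1 / (4 * n)) * quadPot a ℓ) := by
  have hn' : (2 : ℝ) ≤ n := by exact_mod_cast hn
  have h1 : ∑ p ∈ pairs n, quadPot a (balance ℓ p.1 p.2) ≤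
      ∑ p ∈ pairs n, (quadPot a ℓ + 1 / 2 - ((ℓ p.1 : ℝ) - ℓ p.2) ^ 2 / 2) :=
    Finset.sum_le_sum fun p hp => quadPot_balance_le_sub a ℓ (mem_pairs.mp hp)
  rw [Finset.sum_sub_distrib, Finset.sum_const, nsmul_eq_mul, ← Finset.sum_div, sum_sq_sub ha,
    card_pairs] at h1
  rw [card_pairs]
  refine h1.trans ?_
  have e : (n : ℝ) * (n - 1) * ((1 - 1 / (4 * n)) * quadPot a ℓ) =
      n * (n - 1) * quadPot a ℓ - (n - 1) / 4 * quadPot a ℓ := by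
    field_simp
  rw [e]
  nlinarith [mul_pos (by linarith : (0 : ℝ) < n) (sub_pos.mpr hΦ)]

/-- If the quadratic potential is at most `n`, at least half of the nodes are within `2`
of `a`. -/
theorem half_le_card_near {a : ℝ} {ℓ : Fin n → ℤ} (hΦ : quadPot a ℓ ≤ n) :
    (n : ℝ) / 2 ≤ ((Finset.univ.filter fun i => |(ℓ i : ℝ) - a| ≤ 2).card : ℝ) := by
  have h1 : ((Finset.univ.filter fun i => ¬ |(ℓ i : ℝ) - a| ≤ 2).card : ℝ) * 4 ≤ quadPot a ℓ := by
    rw [← nsmul_eq_mul]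
    refine (Finset.card_nsmul_le_sum _ (fun i => ((ℓ i : ℝ) - a) ^ 2) 4 ?_).trans
      (Finset.sum_le_sum_of_subset_of_nonneg (Finset.subset_univ _) fun _ _ _ => sq_nonneg _)
    intro i hi
    have hi' : 2 < |(ℓ i : ℝ) - a| := by simpa using hi
    rw [← sq_abs]
    nlinarith
  have h2 := Finset.card_filter_add_card_filter_not (s := (Finset.univ : Finset (Fin n)))
    (fun i => |(ℓ i : ℝ) - a| ≤ 2)
  have h3 : ((Finset.univ.filter fun i => |(ℓ i : ℝ) - a| ≤ 2).card : ℝ) +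
      ((Finset.univ.filter fun i => ¬ |(ℓ i : ℝ) - a| ≤ 2).card : ℝ) = n := by
    have : (Finset.univ : Finset (Fin n)).card = n := by simp
    rw [this] at h2
    exact_mod_cast h2
  have h4 : (0 : ℝ) ≤ n := Nat.cast_nonneg n
  linarith

theorem excessPot_balance_le (a : ℝ) (ℓ : Fin n → ℤ) {u v : Fin n} (huv : u ≠ v) :
    excessPot a (balance ℓ u v) ≤ excessPot a ℓ -
      (if |(ℓ v : ℝ) - a| ≤ 2 then excessSq ((ℓ u : ℝ) - a) / 2 else 0) := by
  obtain ⟨h1, h2, h3⟩ := balance_spec ℓ huv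
  have e := sum_balance (fun z : ℤ => excessSq ((z : ℝ) - a)) ℓ huv
  simp only [excessPot]
  split_ifs with hv
  · have h := excessSq_balance_le h1 h2 h3 hv
    linarith [excessSq_nonneg ((ℓ v : ℝ) - a)]
  · have h := convexOn_excessSq.balance_le h1 h2 h3 a
    linarith

theorem sum_excessPot_balance_le (hn : 2 ≤ n) {a : ℝ} {ℓ : Fin n → ℤ} (hΦ : quadPot a ℓ ≤ n) :
    ∑ p ∈ pairs n, excessPot a (balance ℓ p.1 p.2) ≤
      (pairs n).card * ((1 - 1 / (4 * n)) * excessPot a ℓ) := by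
  have hn' : (2 : ℝ) ≤ n := by exact_mod_cast hn
  have h1 : ∑ p ∈ pairs n, excessPot a (balance ℓ p.1 p.2) ≤
      ∑ p ∈ pairs n, (excessPot a ℓ -
        (if |(ℓ p.2 : ℝ) - a| ≤ 2 then excessSq ((ℓ p.1 : ℝ) - a) / 2 else 0)) :=
    Finset.sum_le_sum fun p hp => excessPot_balance_le a ℓ (mem_pairs.mp hp)
  have h2 : ∑ p ∈ pairs n,
        (if |(ℓ p.2 : ℝ) - a| ≤ 2 then excessSq ((ℓ p.1 : ℝ) - a) / 2 else 0) =
      ∑ p : Fin n × Fin n,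
        (if |(ℓ p.2 : ℝ) - a| ≤ 2 then excessSq ((ℓ p.1 : ℝ) - a) / 2 else 0) := by
    refine Finset.sum_subset (Finset.subset_univ _) ?_
    intro p _ hp
    have hp' : p.1 = p.2 := by simpa [pairs] using hp
    rw [hp']
    split_ifs with h
    · rw [excessSq_eq_zero (by linarith), zero_div]
    · rfl
  have h3 : n / 4 * excessPot a ℓ ≤ ∑ p : Fin n × Fin n,
        (if |(ℓ p.2 : ℝ) - a| ≤ 2 then excessSq ((ℓ p.1 : ℝ) - a) / 2 else 0) := by
    rw [Fintype.sum_prod_type, excessPot, Finset.mul_sum]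
    refine Finset.sum_le_sum fun u _ => ?_
    dsimp only
    rw [← Finset.sum_filter, Finset.sum_const, nsmul_eq_mul]
    nlinarith [mul_le_mul_of_nonneg_right (half_le_card_near hΦ)
      (excessSq_nonneg ((ℓ u : ℝ) - a))]
  rw [Finset.sum_sub_distrib, Finset.sum_const, nsmul_eq_mul, h2, card_pairs] at h1
  rw [card_pairs]
  have e : (n : ℝ) * (n - 1) * ((1 - 1 / (4 * n)) * excessPot a ℓ) =
      n * (n - 1) * excessPot a ℓ - (n - 1) / 4 * excessPot a ℓ := by
    field_simp
  rw [e]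
  nlinarith [excessPot_nonneg a ℓ]

/-- The quadratic potential as long as it exceeds `n`, the excess potential afterwards. -/
noncomputable def mixedPot (a : ℝ) (ℓ : Fin n → ℤ) : ℝ :=
  open Classical in if n < quadPot a ℓ then quadPot a ℓ else excessPot a ℓ

theorem mixedPot_le_quadPot (a : ℝ) (ℓ : Fin n → ℤ) : mixedPot a ℓ ≤ quadPot a ℓ := by
  unfold mixedPot
  split_ifs
  · exact le_rfl
  · exact excessPot_le_quadPot a ℓ

theorem mixedPot_nonneg (a : ℝ) (ℓ : Fin n → ℤ) : 0 ≤ mixedPot a ℓ := by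
  unfold mixedPot
  split_ifs
  · exact Finset.sum_nonneg fun _ _ => sq_nonneg _
  · exact excessPot_nonneg a ℓ

theorem sum_mixedPot_balance_le (hn : 2 ≤ n) {a : ℝ} {ℓ : Fin n → ℤ}
    (ha : ∑ i, (ℓ i : ℝ) = n * a) :
    ∑ p ∈ pairs n, mixedPot a (balance ℓ p.1 p.2) ≤
      (pairs n).card * ((1 - 1 / (4 * n)) * mixedPot a ℓ) := by
  by_cases h : n < quadPot a ℓ
  · have e : mixedPot a ℓ = quadPot a ℓ := by simp [mixedPot, h]
    rw [e]
    exact (Finset.sum_le_sum fun _ _ => mixedPot_le_quadPot _ _).trans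
      (sum_quadPot_balance_le hn ha h)
  · have e : mixedPot a ℓ = excessPot a ℓ := by simp [mixedPot, h]
    rw [e]
    refine le_trans (le_of_eq (Finset.sum_congr rfl fun p hp => ?_))
      (sum_excessPot_balance_le hn (not_lt.mp h))
    have hle := (quadPot_balance_le a ℓ (mem_pairs.mp hp)).trans (not_lt.mp h)
    simp [mixedPot, not_lt.mpr hle]

theorem one_le_mixedPot (hn : 2 ≤ n) {a : ℝ} {ℓ : Fin n → ℤ} {i : Fin n}
    (hi : 20 < |(ℓ i : ℝ) - a|) : 1 ≤ mixedPot a ℓ := by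
  have hn' : (2 : ℝ) ≤ n := by exact_mod_cast hn
  unfold mixedPot
  split_ifs with h
  · linarith
  · have h1 : excessSq ((ℓ i : ℝ) - a) ≤ excessPot a ℓ :=
      Finset.single_le_sum (f := fun i => excessSq ((ℓ i : ℝ) - a))
        (fun _ _ => excessSq_nonneg _) (Finset.mem_univ i)
    refine le_trans ?_ h1
    rw [excessSq]
    nlinarith [le_max_left (|(ℓ i : ℝ) - a| - 3) 0]

/-- The mixed potential, extended by `⊤` to load vectors whose average is not `a`. -/
noncomputable def extPot (a : ℝ) (ℓ : Fin n → ℤ) : ENNReal :=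
  open Classical in if ∑ i, (ℓ i : ℝ) = n * a then ENNReal.ofReal (mixedPot a ℓ) else ⊤

theorem PMF.tsum_bind_mul {α β : Type*} (p : PMF α) (f : α → PMF β) (W : β → ENNReal) :
    ∑' b, (p.bind f) b * W b = ∑' a, p a * ∑' b, f a b * W b := by
  simp only [PMF.bind_apply, ← ENNReal.tsum_mul_right, ← ENNReal.tsum_mul_left]
  rw [ENNReal.tsum_comm]
  simp only [mul_assoc]

theorem tsum_stepPMF_mul (hn : 2 ≤ n) (ℓ : Fin n → ℤ) (W : (Fin n → ℤ) → ENNReal) :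
    ∑' b, stepPMF hn ℓ b * W b =
      ((pairs n).card : ENNReal)⁻¹ * ∑ p ∈ pairs n, W (balance ℓ p.1 p.2) := by
  have hne : (pairs n).Nonempty :=
    ⟨(⟨0, by omega⟩, ⟨1, by omega⟩), by simp [mem_pairs, Fin.ext_iff]⟩
  have hs : stepPMF hn ℓ =
      (PMF.uniformOfFinset (pairs n) hne).map (fun p => balance ℓ p.1 p.2) := rfl
  rw [hs, PMF.map, PMF.tsum_bind_mul]
  have h : ∀ p : Fin n × Fin n,
      ∑' b, ((PMF.pure ∘ fun p : Fin n × Fin n => balance ℓ p.1 p.2) p) b * W b =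
        W (balance ℓ p.1 p.2) := by
    intro p
    rw [tsum_eq_single (balance ℓ p.1 p.2)]
    · simp
    · intro b hb
      simp [PMF.pure_apply, hb]
  simp only [h]
  rw [tsum_fintype, Finset.mul_sum, ← Finset.sum_subset (Finset.subset_univ (pairs n))]
  · refine Finset.sum_congr rfl fun p hp => ?_
    rw [PMF.uniformOfFinset_apply_of_mem _ hp]
  · intro p _ hp
    rw [PMF.uniformOfFinset_apply_of_notMem _ hp, zero_mul]

theorem tsum_stepPMF_extPot_le (hn : 2 ≤ n) (a : ℝ) (ℓ : Fin n → ℤ) :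
    ∑' b, stepPMF hn ℓ b * extPot a b ≤ ENNReal.ofReal (1 - 1 / (4 * n)) * extPot a ℓ := by
  have hn' : (2 : ℝ) ≤ n := by exact_mod_cast hn
  have hq : (0 : ℝ) < 1 - 1 / (4 * n) := by
    rw [sub_pos, div_lt_one (by linarith)]; linarith
  by_cases ha : ∑ i, (ℓ i : ℝ) = n * a
  · have hcard : (0 : ℝ) < (pairs n).card := by
      rw [card_pairs]; exact mul_pos (by linarith) (by linarith)
    have e : extPot a ℓ = ENNReal.ofReal (mixedPot a ℓ) := by simp [extPot, ha]
    have e' : ∀ p ∈ pairs n, extPot a (balance ℓ p.1 p.2) =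
        ENNReal.ofReal (mixedPot a (balance ℓ p.1 p.2)) := by
      intro p hp
      have hs : ∑ i, (balance ℓ p.1 p.2 i : ℝ) = n * a := by
        rw [← ha]
        exact_mod_cast sum_balance_id ℓ (mem_pairs.mp hp)
      simp [extPot, hs]
    rw [tsum_stepPMF_mul, Finset.sum_congr rfl e', e,
      ← ENNReal.ofReal_sum_of_nonneg fun _ _ => mixedPot_nonneg _ _,
      ← ENNReal.ofReal_mul hq.le, ← ENNReal.ofReal_natCast, ← ENNReal.ofReal_inv_of_pos hcard,
      ← ENNReal.ofReal_mul (inv_nonneg.mpr hcard.le)]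
    refine ENNReal.ofReal_le_ofReal ?_
    rw [inv_mul_le_iff₀ hcard]
    exact sum_mixedPot_balance_le hn ha
  · have e : extPot a ℓ = ⊤ := by simp [extPot, ha]
    rw [e, ENNReal.mul_top (ENNReal.ofReal_pos.mpr hq).ne']
    exact le_top

theorem tsum_iterPMF_extPot_le (hn : 2 ≤ n) (a : ℝ) (ℓ0 : Fin n → ℤ) (t : ℕ) :
    ∑' b, iterPMF hn ℓ0 t b * extPot a b ≤
      ENNReal.ofReal (1 - 1 / (4 * n)) ^ t * extPot a ℓ0 := by
  induction t with
  | zero =>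
    rw [tsum_eq_single ℓ0]
    · simp [iterPMF]
    · intro b hb
      simp [iterPMF, PMF.pure_apply, hb]
  | succ t ih =>
    rw [iterPMF, PMF.tsum_bind_mul]
    calc ∑' ℓ, iterPMF hn ℓ0 t ℓ * ∑' b, stepPMF hn ℓ b * extPot a b
        ≤ ∑' ℓ, iterPMF hn ℓ0 t ℓ * (ENNReal.ofReal (1 - 1 / (4 * n)) * extPot a ℓ) :=
          ENNReal.tsum_le_tsum fun ℓ => mul_le_mul_right (tsum_stepPMF_extPot_le hn a ℓ) _
      _ = ENNReal.ofReal (1 - 1 / (4 * n)) * ∑' ℓ, iterPMF hn ℓ0 t ℓ * extPot a ℓ := by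
          rw [← ENNReal.tsum_mul_left]
          exact tsum_congr fun ℓ => mul_left_comm _ _ _
      _ ≤ _ := by
          rw [pow_succ', mul_assoc]
          exact mul_le_mul_right ih _

/-- Markov inequality for the complement of a set. -/
theorem PMF.one_sub_tsum_le_toOuterMeasure {α : Type*} (p : PMF α) (S : Set α) (W : α → ENNReal)
    (hW : ∀ x ∉ S, 1 ≤ W x) : 1 - ∑' x, p x * W x ≤ p.toOuterMeasure S := by
  rw [tsub_le_iff_right, PMF.toOuterMeasure_apply, ← ENNReal.tsum_add, ← p.tsum_coe]
  refine ENNReal.tsum_le_tsum fun x => ?_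
  by_cases hx : x ∈ S
  · simp [hx]
  · simpa [hx] using mul_le_mul_right (hW x hx) (p x)

theorem quadPot_le_of_discrepancy {a D : ℝ} {ℓ : Fin n → ℤ} (hn : 0 < n)
    (ha : ∑ i, (ℓ i : ℝ) = n * a) (hD : ∀ i j, (ℓ i : ℝ) - ℓ j ≤ D) :
    quadPot a ℓ ≤ n * D ^ 2 := by
  have hn' : (0 : ℝ) < n := by exact_mod_cast hn
  have h : ∀ i, ((ℓ i : ℝ) - a) ^ 2 ≤ D ^ 2 := by
    intro i
    have h1 : ∑ j, ((ℓ i : ℝ) - ℓ j) = n * (ℓ i - a) := by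
      simp [Finset.sum_sub_distrib, ha, mul_sub]
    have h2 : ∑ j, ((ℓ i : ℝ) - ℓ j) ≤ n * D := by
      refine (Finset.sum_le_sum fun j _ => hD i j).trans (le_of_eq ?_)
      simp
    have h3 : n * (-D) ≤ ∑ j, ((ℓ i : ℝ) - ℓ j) := by
      refine le_trans (le_of_eq ?_) (Finset.sum_le_sum fun j _ => (by linarith [hD j i] :
        -D ≤ (ℓ i : ℝ) - ℓ j))
      simp
    rw [h1] at h2 h3
    exact sq_le_sq' (le_of_mul_le_mul_left h3 hn') (le_of_mul_le_mul_left h2 hn')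
  refine (Finset.sum_le_sum fun i _ => h i).trans (le_of_eq ?_)
  simp

theorem pow_ceil_mul_le {x D : ℝ} (hx : 2 ≤ x) (hD : 1 ≤ D) :
    (1 - 1 / (4 * x)) ^ ⌈12 * x * (Real.log x + Real.log D)⌉₊ * (x * D ^ 2) ≤ 1 / x := by
  set t := ⌈12 * x * (Real.log x + Real.log D)⌉₊
  have hx0 : 0 < x := by linarith
  have hD0 : 0 < D := by linarith
  have ht : 12 * x * (Real.log x + Real.log D) ≤ t := Nat.le_ceil _
  have hq : (0 : ℝ) ≤ 1 - 1 / (4 * x) := by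
    rw [sub_nonneg, div_le_one (by linarith)]; linarith
  have h1 : (1 - 1 / (4 * x)) ^ t ≤ Real.exp (-(3 * (Real.log x + Real.log D))) := by
    calc (1 - 1 / (4 * x)) ^ t ≤ Real.exp (-(1 / (4 * x))) ^ t :=
          pow_le_pow_left₀ hq (by linarith [Real.add_one_le_exp (-(1 / (4 * x)))]) t
      _ = Real.exp (t * -(1 / (4 * x))) := (Real.exp_nat_mul _ t).symm
      _ ≤ _ := by
          refine Real.exp_le_exp.mpr ?_
          rw [mul_neg, neg_le_neg_iff, mul_one_div, le_div_iff₀ (by linarith)]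
          linarith
  have h2 : Real.exp (-(3 * (Real.log x + Real.log D))) = 1 / (x * D) ^ 3 := by
    rw [← Real.log_mul hx0.ne' hD0.ne', Real.exp_neg,
      show (3 : ℝ) * Real.log (x * D) = ((3 : ℕ) : ℝ) * Real.log (x * D) by norm_num,
      Real.exp_nat_mul, Real.exp_log (mul_pos hx0 hD0), one_div]
  rw [h2] at h1
  refine (mul_le_mul_of_nonneg_right h1 (by positivity)).trans ?_
  rw [one_div_mul_eq_div, div_le_div_iff₀ (by positivity) hx0]
  have e1 : x * D ^ 2 * x = x ^ 2 * D ^ 2 * 1 := by ring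
  have e2 : 1 * (x * D) ^ 3 = x ^ 2 * D ^ 2 * (x * D) := by ring
  rw [e1, e2]
  exact mul_le_mul_of_nonneg_left (by nlinarith) (by positivity)

end Helpers

/-- **End of Phase 2 (constant discrepancy).** There is a constant `C > 0` such that for every
`n ≥ 2` and every initial load vector `ℓ⁰ ∈ ℕⁿ` of initial discrepancy `Δ ≥ 1`, after
`⌈C·n·(log n + log Δ)⌉` steps of the balancing process the probability that every node's
load lies in `[ā − 20, ā + 20]` is at least `1 − C/n`, where `ā = (∑ i ℓ⁰ i)/n`. -/
theorem all_loads_within_twenty_of_average :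
    ∃ C : ℝ, 0 < C ∧
      ∀ (n : ℕ) (hn : 2 ≤ n) (ℓ0 : Fin n → ℤ),
        (∀ i, 0 ≤ ℓ0 i) →
        ∀ Δ : ℤ,
          Δ = Finset.univ.sup' ⟨⟨0, by omega⟩, Finset.mem_univ _⟩ ℓ0
                - Finset.univ.inf' ⟨⟨0, by omega⟩, Finset.mem_univ _⟩ ℓ0 →
          1 ≤ Δ →
          ENNReal.ofReal (1 - C / n) ≤
            (iterPMF hn ℓ0 ⌈C * n * (Real.log n + Real.log Δ)⌉₊).toOuterMeasure
              {ℓ | ∀ i,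
                ((∑ j, ℓ0 j : ℤ) : ℚ) / (n : ℚ) - 20 ≤ (ℓ i : ℚ) ∧
                (ℓ i : ℚ) ≤ ((∑ j, ℓ0 j : ℤ) : ℚ) / (n : ℚ) + 20} := by
  refine ⟨12, by norm_num, ?_⟩
  intro n hn ℓ0 _ Δ hΔ hΔ1
  have hn' : (2 : ℝ) ≤ n := by exact_mod_cast hn
  have hn0 : (n : ℝ) ≠ 0 := by linarith
  have hΔ1' : (1 : ℝ) ≤ Δ := by exact_mod_cast hΔ1
  set a : ℝ := (∑ j, (ℓ0 j : ℝ)) / n with ha_def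
  have ha : ∑ i, (ℓ0 i : ℝ) = n * a := by rw [ha_def]; field_simp
  have hD : ∀ i j, (ℓ0 i : ℝ) - ℓ0 j ≤ Δ := by
    intro i j
    have h1 := Finset.le_sup' ℓ0 (Finset.mem_univ i)
    have h2 := Finset.inf'_le ℓ0 (Finset.mem_univ j)
    exact_mod_cast (by rw [hΔ]; exact sub_le_sub h1 h2 : ℓ0 i - ℓ0 j ≤ Δ)
  set t := ⌈12 * n * (Real.log n + Real.log Δ)⌉₊ with ht
  have hq : (0 : ℝ) ≤ 1 - 1 / (4 * n) := by
    rw [sub_nonneg, div_le_one (by linarith)]; linarith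
  have hE : ∑' b, iterPMF hn ℓ0 t b * extPot a b ≤ ENNReal.ofReal (12 / n) := by
    refine (tsum_iterPMF_extPot_le hn a ℓ0 t).trans ?_
    have e : extPot a ℓ0 = ENNReal.ofReal (mixedPot a ℓ0) := by simp [extPot, ha]
    rw [e, ← ENNReal.ofReal_pow hq, ← ENNReal.ofReal_mul (pow_nonneg hq t)]
    refine ENNReal.ofReal_le_ofReal ?_
    calc (1 - 1 / (4 * (n : ℝ))) ^ t * mixedPot a ℓ0
        ≤ (1 - 1 / (4 * (n : ℝ))) ^ t * (n * (Δ : ℝ) ^ 2) :=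
          mul_le_mul_of_nonneg_left ((mixedPot_le_quadPot a ℓ0).trans
            (quadPot_le_of_discrepancy (by omega) ha hD)) (pow_nonneg hq t)
      _ ≤ 1 / n := pow_ceil_mul_le hn' hΔ1'
      _ ≤ 12 / n := by gcongr; norm_num
  rw [ENNReal.ofReal_sub 1 (by positivity), ENNReal.ofReal_one]
  refine (tsub_le_tsub_left hE 1).trans
    (PMF.one_sub_tsum_le_toOuterMeasure _ _ (extPot a) fun ℓ hℓ => ?_)
  by_cases hs : ∑ i, (ℓ i : ℝ) = n * a
  · have e : extPot a ℓ = ENNReal.ofReal (mixedPot a ℓ) := by simp [extPot, hs]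
    rw [e, ENNReal.one_le_ofReal]
    by_contra hlt
    refine hℓ fun i => ?_
    have hi : |(ℓ i : ℝ) - a| ≤ 20 := by
      by_contra h
      exact hlt (one_le_mixedPot hn (not_le.mp h))
    obtain ⟨h1, h2⟩ := abs_le.mp hi
    have cast_avg : ((((∑ j, ℓ0 j : ℤ) : ℚ) / (n : ℚ) : ℚ) : ℝ) = a := by
      rw [ha_def]; push_cast; rfl
    constructor
    · rw [← Rat.cast_le (K := ℝ), Rat.cast_sub, cast_avg]
      push_cast
      linarith
    · rw [← Rat.cast_le (K := ℝ), Rat.cast_add, cast_avg]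
      push_cast
      linarith
  · have e : extPot a ℓ = ⊤ := by simp [extPot, hs]
    rw [e]
    exact le_top
end

section
/- For all integers x, y and every real number a, one has (⌈(x+y)/2⌉ − a)² + (⌊(x+y)/2⌋ − a)² ≤ (x − a)² + (y − a)². In particular, the potential Φ(ℓ) = ∑ᵢ (ℓᵢ − ā)² never increases when any two nodes balance their loads. -/
open scoped BigOperators

/-- The potential `Φ(ℓ) = ∑ i (ℓ i − ā)²`, where `ā = (∑ i ℓ i)/n` is the average load. -/
noncomputable def potential {n : ℕ} (ℓ : Fin n → ℤ) : ℝ :=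
  ∑ i, ((ℓ i : ℝ) - ((∑ j, ℓ j : ℤ) : ℝ) / n) ^ 2

theorem floor_intCast_div_two (k : ℤ) : ⌊(k : ℚ) / 2⌋ = k / 2 := by
  exact_mod_cast Rat.floor_intCast_div_natCast k 2

theorem ceil_intCast_div_two (k : ℤ) : ⌈(k : ℚ) / 2⌉ = k - k / 2 := by
  have h : ⌈(k : ℚ) / 2⌉ = -(-k / 2) := by
    exact_mod_cast Rat.ceil_intCast_div_natCast k 2
  omega

/-- Halving the sum of two integers, with rounding, does not increase the sum of squared
deviations from any real number. -/
theorem sq_ceil_half_add_sq_floor_half_le (x y : ℤ) (a : ℝ) :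
    ((⌈(((x + y : ℤ) : ℚ)) / 2⌉ : ℝ) - a) ^ 2 + ((⌊(((x + y : ℤ) : ℚ)) / 2⌋ : ℝ) - a) ^ 2
      ≤ ((x : ℝ) - a) ^ 2 + ((y : ℝ) - a) ^ 2 := by
  rw [ceil_intCast_div_two, floor_intCast_div_two]
  obtain ⟨f, hf⟩ : ∃ f, f = (x + y) / 2 := ⟨_, rfl⟩
  rw [← hf]
  have h : 0 ≤ (x - f) * (y - f) * (-1) := by
    rcases le_total x y with hxy | hxy
    · have h₁ : x ≤ f := by omega
      have h₂ : f ≤ y := by omega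
      nlinarith
    · have h₁ : f ≤ x := by omega
      have h₂ : y ≤ f := by omega
      nlinarith
  have h' : 0 ≤ ((x : ℝ) - f) * (y - f) * (-1) := by exact_mod_cast h
  push_cast
  nlinarith

/-- A sum over a finite type, with the terms at two distinct points split off. -/
theorem sum_eq_add_add_sum_erase_erase {ι M : Type*} [Fintype ι] [DecidableEq ι]
    [AddCommMonoid M] {u v : ι} (huv : u ≠ v) (f : ι → M) :
    ∑ i, f i = f u + f v + ∑ i ∈ (Finset.univ.erase u).erase v, f i := by
  rw [← Finset.add_sum_erase _ f (Finset.mem_univ u),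
    ← Finset.add_sum_erase _ f (Finset.mem_erase.mpr ⟨huv.symm, Finset.mem_univ v⟩), add_assoc]

section balance

variable {n : ℕ} (ℓ : Fin n → ℤ) {u v : Fin n}

theorem sum_comp_balance {M : Type*} [AddCommMonoid M] (huv : u ≠ v) (g : ℤ → M) :
    ∑ i, g (balance ℓ u v i) =
      g ⌈(((ℓ u + ℓ v : ℤ) : ℚ)) / 2⌉ + g ⌊(((ℓ u + ℓ v : ℤ) : ℚ)) / 2⌋ +
        ∑ i ∈ (Finset.univ.erase u).erase v, g (ℓ i) := by
  rw [sum_eq_add_add_sum_erase_erase huv]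
  congr 1
  · simp only [balance, if_true, if_neg huv.symm]
  · refine Finset.sum_congr rfl fun i hi => ?_
    simp only [Finset.mem_erase] at hi
    simp only [balance, if_neg hi.1, if_neg hi.2.1]

/-- Balancing preserves the total load. -/
theorem sum_balance_s4 (huv : u ≠ v) : ∑ i, balance ℓ u v i = ∑ i, ℓ i := by
  rw [sum_comp_balance ℓ huv fun x => x, sum_eq_add_add_sum_erase_erase huv ℓ,
    ceil_intCast_div_two, floor_intCast_div_two, sub_add_cancel]

end balance

/-- **Balancing never increases the potential.** For integers `x, y` and a real `a`,
`(⌈(x+y)/2⌉ − a)² + (⌊(x+y)/2⌋ − a)² ≤ (x − a)² + (y − a)²`; in particular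
`Φ(balance ℓ u v) ≤ Φ(ℓ)` for any two distinct nodes `u, v`. -/
theorem balancing_never_increases_potential :
    (∀ (x y : ℤ) (a : ℝ),
      ((⌈(((x + y : ℤ) : ℚ)) / 2⌉ : ℝ) - a) ^ 2 + ((⌊(((x + y : ℤ) : ℚ)) / 2⌋ : ℝ) - a) ^ 2
        ≤ ((x : ℝ) - a) ^ 2 + ((y : ℝ) - a) ^ 2) ∧
    (∀ (n : ℕ) (ℓ : Fin n → ℤ) (u v : Fin n), u ≠ v →
      potential (balance ℓ u v) ≤ potential ℓ) := by
  refine ⟨sq_ceil_half_add_sq_floor_half_le, fun n ℓ u v huv => ?_⟩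
  unfold potential
  rw [sum_balance_s4 ℓ huv, sum_comp_balance ℓ huv fun x : ℤ =>
      ((x : ℝ) - ((∑ j, ℓ j : ℤ) : ℝ) / n) ^ 2, sum_eq_add_add_sum_erase_erase huv fun i =>
      ((ℓ i : ℝ) - ((∑ j, ℓ j : ℤ) : ℝ) / n) ^ 2]
  gcongr ?_ + _
  exact sq_ceil_half_add_sq_floor_half_le _ _ _
end
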